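/- arXiv:2511.22437 — 7 statements merged into one kernel-verified Lean document; each statement's English description precedes it below -/
import Mathlib

section
/- Let E be a real normed vector space (the space of parameters), let d ≥ 1, and let φ : Fin d → E → EuclideanSpace ℂ (Fin d) be a family of maps such that each φ j is differentiable and, for every point x of E, the vectors (φ j x)_{j=1,…,d} form an orthonormal basis of EuclideanSpace ℂ (Fin d). Then the sum over j of the curvature 2-forms F^{(j)} = i⟨dφ_j| ∧ |dφ_j⟩ vanishes identically; concretely, for every x ∈ E and every pair of tangent directions u, v ∈ E, ∑_{j} ( ⟪(fderiv ℝ (φ j) x) u, (fderiv ℝ (φ j) x) v⟫ − ⟪(fderiv ℝ (φ j) x) v, (fderiv ℝ (φ j) x) u⟫ ) = 0. -/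
open scoped InnerProductSpace

/-- Differentiating a constant inner product gives the Leibniz identity with vanishing sum. -/
theorem inner_fderiv_eq_neg_of_inner_const
    {E F : Type*} [NormedAddCommGroup E] [NormedSpace ℝ E]
    [NormedAddCommGroup F] [InnerProductSpace ℂ F] [NormedSpace ℝ F] [IsScalarTower ℝ ℂ F]
    {f g : E → F} {c : ℂ} {x : E} (hf : DifferentiableAt ℝ f x) (hg : DifferentiableAt ℝ g x)
    (hc : ∀ y, ⟪f y, g y⟫_ℂ = c) (w : E) :
    ⟪fderiv ℝ f x w, g x⟫_ℂ = -⟪f x, fderiv ℝ g x w⟫_ℂ := by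
  have h := fderiv_inner_apply ℂ hf hg w
  simp only [hc, fderiv_fun_const, Pi.zero_apply, zero_apply] at h
  linear_combination -h

/-- If the infinitesimal variations `a` and `b` of an orthonormal basis are both skew-Hermitian,
then the sum of the inner products `⟪a j, b j⟫` is symmetric in `a` and `b`. -/
theorem OrthonormalBasis.sum_inner_comm_of_skew
    {ι F : Type*} [Fintype ι] [NormedAddCommGroup F] [InnerProductSpace ℂ F]
    (e : OrthonormalBasis ι ℂ F) {a b : ι → F}
    (ha : ∀ j k, ⟪a j, e k⟫_ℂ = -⟪e j, a k⟫_ℂ)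
    (hb : ∀ j k, ⟪b j, e k⟫_ℂ = -⟪e j, b k⟫_ℂ) :
    ∑ j, ⟪a j, b j⟫_ℂ = ∑ j, ⟪b j, a j⟫_ℂ := by
  calc ∑ j, ⟪a j, b j⟫_ℂ
      = ∑ j, ∑ k, -⟪e j, a k⟫_ℂ * ⟪e k, b j⟫_ℂ := by
        simp only [← ha, e.sum_inner_mul_inner]
    _ = ∑ j, ∑ k, -⟪e j, b k⟫_ℂ * ⟪e k, a j⟫_ℂ := by
        rw [Finset.sum_comm]
        exact Finset.sum_congr rfl fun j _ => Finset.sum_congr rfl fun k _ => by ring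
    _ = ∑ j, ⟪b j, a j⟫_ℂ := by
        simp only [← hb, e.sum_inner_mul_inner]

theorem sum_of_curvature_two_forms_vanishes
    {E : Type*} [NormedAddCommGroup E] [NormedSpace ℝ E]
    {d : ℕ} (hd : 1 ≤ d)
    (φ : Fin d → E → EuclideanSpace ℂ (Fin d))
    (hdiff : ∀ j, Differentiable ℝ (φ j))
    (horth : ∀ x : E, Orthonormal ℂ (fun j => φ j x))
    (x u v : E) :
    ∑ j : Fin d,
      (⟪(fderiv ℝ (φ j) x) u, (fderiv ℝ (φ j) x) v⟫_ℂ
        - ⟪(fderiv ℝ (φ j) x) v, (fderiv ℝ (φ j) x) u⟫_ℂ) = 0 := by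
  have hspan : ⊤ ≤ Submodule.span ℂ (Set.range fun j => φ j x) :=
    ((horth x).linearIndependent.span_eq_top_of_card_eq_finrank' (by simp)).ge
  let e := OrthonormalBasis.mk (horth x) hspan
  have he : ∀ j, e j = φ j x := fun j => by simp [e]
  have hskew : ∀ w j k,
      ⟪fderiv ℝ (φ j) x w, e k⟫_ℂ = -⟪e j, fderiv ℝ (φ k) x w⟫_ℂ := fun w j k => by
    rw [he, he]
    exact inner_fderiv_eq_neg_of_inner_const (hdiff j x) (hdiff k x)
      (fun y => orthonormal_iff_ite.mp (horth y) j k) w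
  rw [Finset.sum_sub_distrib, sub_eq_zero]
  exact e.sum_inner_comm_of_skew (hskew u) (hskew v)
end

section
/- Let E be a real normed vector space, let d ≥ 1, and let φ : Fin d → E → EuclideanSpace ℂ (Fin d) be such that each φ j is differentiable and, for every x ∈ E, the vectors (φ j x)_{j} form an orthonormal basis. Then for every x ∈ E and all directions u, v ∈ E the complex number ∑_{j} ⟪(fderiv ℝ (φ j) x) u, (fderiv ℝ (φ j) x) v⟫ is real, i.e. its imaginary part vanishes. -/
open scoped InnerProductSpace

/-- Differentiating the orthonormality relations of a moving frame. -/
theorem inner_fderiv_left_eq_neg_of_orthonormal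
    {E F ι : Type*} [NormedAddCommGroup E] [NormedSpace ℝ E]
    [NormedAddCommGroup F] [InnerProductSpace ℂ F]
    {φ : ι → E → F} {x : E} (hdiff : ∀ j, DifferentiableAt ℝ (φ j) x)
    (horth : ∀ y : E, Orthonormal ℂ (fun j => φ j y)) (j k : ι) (u : E) :
    ⟪fderiv ℝ (φ j) x u, φ k x⟫_ℂ = -⟪φ j x, fderiv ℝ (φ k) x u⟫_ℂ := by
  classical
  have hconst : (fun y => ⟪φ j y, φ k y⟫_ℂ) = fun _ => if j = k then (1 : ℂ) else 0 :=
    funext fun y => orthonormal_iff_ite.mp (horth y) j k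
  have hderiv := fderiv_inner_apply ℂ (hdiff j) (hdiff k) u
  rw [hconst, fderiv_const_apply, zero_apply] at hderiv
  linear_combination -hderiv

theorem sum_inner_fderiv_is_real
    {E : Type*} [NormedAddCommGroup E] [NormedSpace ℝ E]
    {d : ℕ} (hd : 1 ≤ d)
    (φ : Fin d → E → EuclideanSpace ℂ (Fin d))
    (hdiff : ∀ j, Differentiable ℝ (φ j))
    (horth : ∀ x : E, Orthonormal ℂ (fun j => φ j x))
    (x u v : E) :
    (∑ j : Fin d,
      ⟪(fderiv ℝ (φ j) x) u, (fderiv ℝ (φ j) x) v⟫_ℂ).im = 0 := by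
  have hspan : ⊤ ≤ Submodule.span ℂ (Set.range fun j => φ j x) :=
    ((horth x).linearIndependent.span_eq_top_of_card_eq_finrank' (by simp)).ge
  let b := OrthonormalBasis.mk (horth x) hspan
  have hexpand (a c : EuclideanSpace ℂ (Fin d)) :
      ∑ k, ⟪a, φ k x⟫_ℂ * ⟪φ k x, c⟫_ℂ = ⟪a, c⟫_ℂ := by
    simpa [b] using b.sum_inner_mul_inner a c
  have hskew := inner_fderiv_left_eq_neg_of_orthonormal (fun j => hdiff j x) horth
  rw [← Complex.conj_eq_iff_im, map_sum]
  calc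
    ∑ j, (starRingEnd ℂ) ⟪fderiv ℝ (φ j) x u, fderiv ℝ (φ j) x v⟫_ℂ
      = ∑ j, ∑ k, ⟪fderiv ℝ (φ j) x v, φ k x⟫_ℂ * ⟪φ k x, fderiv ℝ (φ j) x u⟫_ℂ :=
        Finset.sum_congr rfl fun j _ => by rw [inner_conj_symm, hexpand]
    _ = ∑ k, ∑ j, ⟪fderiv ℝ (φ j) x v, φ k x⟫_ℂ * ⟪φ k x, fderiv ℝ (φ j) x u⟫_ℂ :=
        Finset.sum_comm
    _ = ∑ k, ∑ j, ⟪fderiv ℝ (φ k) x u, φ j x⟫_ℂ * ⟪φ j x, fderiv ℝ (φ k) x v⟫_ℂ :=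
        Finset.sum_congr rfl fun k _ => Finset.sum_congr rfl fun j _ => by
          rw [hskew j k v, hskew k j u]
          ring
    _ = ∑ k, ⟪fderiv ℝ (φ k) x u, fderiv ℝ (φ k) x v⟫_ℂ :=
        Finset.sum_congr rfl fun k _ => hexpand _ _
end

section
/- Let E be a real normed vector space and let x₀, x₁ : E → ℂ be differentiable functions. Define φ₁, φ₂ : E → EuclideanSpace ℂ (Fin 2) by φ₁ = (x₀, x₁) and φ₂ = (−conj(x₁), conj(x₀)) componentwise. Then the two curvature contributions cancel identically: for every x ∈ E and all directions u, v ∈ E, ( ⟪D_u φ₁, D_v φ₁⟫ − ⟪D_v φ₁, D_u φ₁⟫ ) + ( ⟪D_u φ₂, D_v φ₂⟫ − ⟪D_v φ₂, D_u φ₂⟫ ) = 0, where D_u φ_i = (fderiv ℝ φ_i x) u. (No orthonormality or normalization assumption on x₀, x₁ is needed.) -/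
open scoped InnerProductSpace ComplexConjugate

theorem HasFDerivAt.fderiv_toLp_pair_apply {E : Type*} [NormedAddCommGroup E] [NormedSpace ℝ E]
    {f g : E → ℂ} {f' g' : E →L[ℝ] ℂ} {x : E}
    (hf : HasFDerivAt f f' x) (hg : HasFDerivAt g g' x) (u : E) :
    fderiv ℝ (fun y => (WithLp.toLp 2 ![f y, g y] : EuclideanSpace ℂ (Fin 2))) x u
      = WithLp.toLp 2 ![f' u, g' u] := by
  have h : DifferentiableAt ℝ
      (fun y => (WithLp.toLp 2 ![f y, g y] : EuclideanSpace ℂ (Fin 2))) x := by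
    rw [differentiableAt_piLp]
    intro i
    fin_cases i
    · exact hf.differentiableAt
    · exact hg.differentiableAt
  have key (i : Fin 2) := (PiLp.hasFDerivAt_apply (𝕜 := ℝ) 2 _ i).comp x h.hasFDerivAt
  ext i
  fin_cases i
  · exact DFunLike.congr_fun ((key 0).unique hf) u
  · exact DFunLike.congr_fun ((key 1).unique hg) u

theorem hasFDerivAt_conj {E : Type*} [NormedAddCommGroup E] [NormedSpace ℝ E]
    {f : E → ℂ} {x : E} (hf : DifferentiableAt ℝ f x) :
    HasFDerivAt (fun y => conj (f y)) ((Complex.conjCLE : ℂ →L[ℝ] ℂ).comp (fderiv ℝ f x)) x :=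
  (Complex.conjCLE : ℂ →L[ℝ] ℂ).hasFDerivAt.comp x hf.hasFDerivAt

theorem qubit_curvature_cancellation
    {E : Type*} [NormedAddCommGroup E] [NormedSpace ℝ E]
    (x₀ x₁ : E → ℂ)
    (h₀ : Differentiable ℝ x₀) (h₁ : Differentiable ℝ x₁)
    (φ₁ φ₂ : E → EuclideanSpace ℂ (Fin 2))
    (hφ₁ : ∀ x : E, φ₁ x = ![x₀ x, x₁ x])
    (hφ₂ : ∀ x : E, φ₂ x = ![-(conj (x₁ x)), conj (x₀ x)])
    (x u v : E) :
    (⟪(fderiv ℝ φ₁ x) u, (fderiv ℝ φ₁ x) v⟫_ℂ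
      - ⟪(fderiv ℝ φ₁ x) v, (fderiv ℝ φ₁ x) u⟫_ℂ)
    + (⟪(fderiv ℝ φ₂ x) u, (fderiv ℝ φ₂ x) v⟫_ℂ
      - ⟪(fderiv ℝ φ₂ x) v, (fderiv ℝ φ₂ x) u⟫_ℂ) = 0 := by
  have e₁ : φ₁ = fun y => WithLp.toLp 2 ![x₀ y, x₁ y] := funext fun y => by ext i; simp [hφ₁]
  have e₂ : φ₂ = fun y => WithLp.toLp 2 ![-conj (x₁ y), conj (x₀ y)] :=
    funext fun y => by ext i; simp [hφ₂]
  subst e₁ e₂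
  have d₁ := (h₀ x).hasFDerivAt.fderiv_toLp_pair_apply (h₁ x).hasFDerivAt
  have d₂ := (hasFDerivAt_conj (h₁ x)).fun_neg.fderiv_toLp_pair_apply (hasFDerivAt_conj (h₀ x))
  rw [d₁, d₁, d₂, d₂]
  simp [PiLp.inner_apply, Fin.sum_univ_two]
  ring
end

section
/- Let d ≥ 1 and T > 0. Let φ : Fin d → ℝ → EuclideanSpace ℂ (Fin d) be a family of continuously differentiable curves such that for every time s the vectors (φ j s)_{j} form an orthonormal basis, and such that every curve is cyclic: φ j T = φ j 0 for all j. Define the geometric phase of the j-th state by γ_j = i ∫_{0}^{T} ⟪φ j s, deriv (φ j) s⟫ ds. Then the product of the geometric phase factors is trivial: ∏_{j} exp(i γ_j) = exp( − ∑_{j} ∫_{0}^{T} ⟪φ j s, deriv (φ j) s⟫ ds ) = 1. -/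
open scoped InnerProductSpace

theorem AlternatingMap.sum_update_orthonormalBasis {ι 𝕜 E F : Type*} [RCLike 𝕜] [Fintype ι]
    [DecidableEq ι] [NormedAddCommGroup E] [InnerProductSpace 𝕜 E] [AddCommGroup F] [Module 𝕜 F]
    (f : E [⋀^ι]→ₗ[𝕜] F) (b : OrthonormalBasis ι 𝕜 E) (w : ι → E) :
    ∑ j, f (Function.update b j (w j)) = (∑ j, ⟪b j, w j⟫_𝕜) • f b := by
  rw [Finset.sum_smul]
  refine Finset.sum_congr rfl fun j _ => ?_
  conv_lhs => rw [← b.sum_repr' (w j), f.map_update_sum]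
  rw [Finset.sum_eq_single j]
  · rw [f.map_update_smul, Function.update_eq_self]
  · intro k _ hk
    rw [f.map_update_smul, f.map_update_self _ hk.symm, smul_zero]
  · simp

theorem ContinuousAlternatingMap.hasDerivAt_apply_orthonormalBasis {ι E F : Type*}
    [Fintype ι] [NormedAddCommGroup E] [InnerProductSpace ℂ E]
    [NormedAddCommGroup F] [NormedSpace ℂ F] (f : E [⋀^ι]→L[ℂ] F) {φ : ι → ℝ → E} {φ' : ι → E}
    {s : ℝ} (hφ : ∀ j, HasDerivAt (φ j) (φ' j) s) (b : OrthonormalBasis ι ℂ E)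
    (hb : ∀ j, b j = φ j s) :
    HasDerivAt (fun t => f fun j => φ j t) ((∑ j, ⟪φ j s, φ' j⟫_ℂ) • f fun j => φ j s) s := by
  classical
  have h := (HasFDerivAt.multilinear_comp (f.toContinuousMultilinearMap.restrictScalars ℝ)
    fun j => (hφ j).hasFDerivAt).hasDerivAt
  have hb' : (fun j => φ j s) = b := funext fun j => (hb j).symm
  convert! h using 1
  simp only [← hb]
  simpa [hb'] using (f.toAlternatingMap.sum_update_orthonormalBasis b φ').symm

/-- The determinant with respect to a basis, as a continuous alternating map. -/
noncomputable def Module.Basis.continuousDet {ι E : Type*} [Fintype ι] [DecidableEq ι]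
    [NormedAddCommGroup E] [NormedSpace ℂ E] [FiniteDimensional ℂ E] (b : Module.Basis ι ℂ E) :
    E [⋀^ι]→L[ℂ] ℂ :=
  { b.det with
    cont := by
      change Continuous fun v : ι → E => (b.toMatrix v).det
      refine Continuous.matrix_det (continuous_matrix fun i j => ?_)
      exact (b.coord i).continuous_of_finiteDimensional.comp (continuous_apply j) }

/-- **Liouville's formula** for a scalar linear differential equation. -/
theorem exp_neg_integral_mul_eq_of_hasDerivAt {a g : ℝ → ℂ} (ha : Continuous a)
    (hg : ∀ s, HasDerivAt g (a s * g s) s) (x y : ℝ) :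
    Complex.exp (-∫ s in x..y, a s) * g y = g x := by
  have h : ∀ t, HasDerivAt (fun t => Complex.exp (-∫ s in x..t, a s) * g t) 0 t := fun t => by
    convert! ((ha.integral_hasStrictDerivAt x t).hasDerivAt.neg.cexp).mul (hg t) using 1
    simp only [Pi.neg_apply]
    ring
  simpa using is_const_of_deriv_eq_zero (fun t => (h t).differentiableAt)
    (fun t => (h t).deriv) y x

theorem geometric_phase_sum_rule
    {d : ℕ} (hd : 1 ≤ d) (T : ℝ) (hT : 0 < T)
    (φ : Fin d → ℝ → EuclideanSpace ℂ (Fin d))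
    (hC1 : ∀ j, ContDiff ℝ 1 (φ j))
    (horth : ∀ s : ℝ, Orthonormal ℂ (fun j => φ j s))
    (hcyc : ∀ j, φ j T = φ j 0) :
    ∏ j : Fin d, Complex.exp (Complex.I *
        (Complex.I * ∫ s in (0:ℝ)..T, ⟪φ j s, deriv (φ j) s⟫_ℂ))
      = 1 ∧
    Complex.exp (- ∑ j : Fin d, ∫ s in (0:ℝ)..T, ⟪φ j s, deriv (φ j) s⟫_ℂ)
      = 1 := by
  have hcont : ∀ j, Continuous fun s => ⟪φ j s, deriv (φ j) s⟫_ℂ := fun j =>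
    (hC1 j).continuous.inner ((hC1 j).continuous_deriv le_rfl)
  have hspan : ∀ s, ⊤ ≤ Submodule.span ℂ (Set.range fun j => φ j s) := fun s =>
    ((horth s).linearIndependent.span_eq_top_of_card_eq_finrank' (by simp)).ge
  let f := (EuclideanSpace.basisFun (Fin d) ℂ).toBasis.continuousDet
  have hf : (f fun j => φ j 0) ≠ 0 :=
    (((EuclideanSpace.basisFun (Fin d) ℂ).toBasis.is_basis_iff_det).1
      ⟨(horth 0).linearIndependent, top_le_iff.1 (hspan 0)⟩).ne_zero
  have hdet := exp_neg_integral_mul_eq_of_hasDerivAt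
    (continuous_finsetSum Finset.univ fun j _ => hcont j)
    (fun s => f.hasDerivAt_apply_orthonormalBasis
      (fun j => ((hC1 j).differentiable one_ne_zero s).hasDerivAt)
      (OrthonormalBasis.mk (horth s) (hspan s)) (fun j => by simp)) 0 T
  simp only [hcyc] at hdet
  rw [intervalIntegral.integral_finsetSum fun j _ => (hcont j).intervalIntegrable 0 T] at hdet
  have hexp := (mul_eq_right₀ hf).1 hdet
  refine ⟨?_, hexp⟩
  rw [← Complex.exp_sum, ← hexp]
  simp only [← mul_assoc, Complex.I_mul_I, neg_one_mul, Finset.sum_neg_distrib]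
end

section
/- Let d ≥ 1 and T > 0. Let φ : Fin d → ℝ → EuclideanSpace ℂ (Fin d) be a family of continuously differentiable curves such that for every time s the vectors (φ j s)_{j} form an orthonormal basis, and φ j T = φ j 0 for all j. Then the sum of the geometric phases is an integer multiple of 2π: there exists n : ℤ such that ∑_{j} i ∫_{0}^{T} ⟪φ j s, deriv (φ j) s⟫ ds = 2πn (as complex numbers, the left-hand side being real). -/
open scoped InnerProductSpace

/-- An alternating map evaluated on an orthonormal basis with one vector replaced by `w` is
multiplied by the component of `w` along the vector that was replaced. -/
theorem AlternatingMap.map_update_orthonormalBasis {ι E F : Type*} [Fintype ι] [DecidableEq ι]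
    [NormedAddCommGroup E] [InnerProductSpace ℂ E] [AddCommGroup F] [Module ℂ F]
    (f : E [⋀^ι]→ₗ[ℂ] F) (b : OrthonormalBasis ι ℂ E) (i : ι) (w : E) :
    f (Function.update b i w) = ⟪b i, w⟫_ℂ • f b := by
  conv_lhs => rw [← b.sum_repr' w]
  rw [f.map_update_sum, Finset.sum_eq_single i]
  · rw [f.map_update_smul, Function.update_eq_self]
  · intro k _ hk
    rw [f.map_update_smul, f.map_update_self _ hk.symm, smul_zero]
  · simp

/-- Jacobi's formula along a differentiable family of orthonormal bases. -/
theorem hasDerivAt_det_orthonormal {ι E : Type*} [Fintype ι] [DecidableEq ι]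
    [NormedAddCommGroup E] [InnerProductSpace ℂ E] (e : Module.Basis ι ℂ E)
    {φ : ι → ℝ → E} {φ' : ι → E} {s : ℝ} (hφ : ∀ j, HasDerivAt (φ j) (φ' j) s)
    (b : OrthonormalBasis ι ℂ E) (hb : ∀ j, b j = φ j s) :
    HasDerivAt (fun t => e.det (fun j => φ j t))
      ((∑ j, ⟪φ j s, φ' j⟫_ℂ) * e.det (fun j => φ j s)) s := by
  have : FiniteDimensional ℂ E := e.finiteDimensional_of_finite
  have hcont : Continuous fun v : ι → E => e.det v := by
    simp only [e.det_apply]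
    refine Continuous.matrix_det (continuous_matrix fun i j => ?_)
    exact (e.coord i).continuous_of_finiteDimensional.comp (continuous_apply j)
  let f : ContinuousMultilinearMap ℂ (fun _ : ι => E) ℂ := ⟨e.det.toMultilinearMap, hcont⟩
  have hf : HasFDerivAt f (f.linearDeriv fun j => φ j s) (fun j => φ j s) :=
    f.hasFDerivAt _
  have h := (hf.restrictScalars ℝ).comp_hasDerivAt s (hasDerivAt_pi.2 hφ)
  refine h.congr_deriv ?_
  have hb' : (fun j => φ j s) = b := funext fun j => (hb j).symm
  rw [ContinuousLinearMap.coe_restrictScalars', ContinuousMultilinearMap.linearDeriv_apply,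
    Finset.sum_mul]
  refine Finset.sum_congr rfl fun i _ => ?_
  rw [hb', ← hb i]
  exact e.det.map_update_orthonormalBasis b i (φ' i)

/-- The solution of a scalar homogeneous linear differential equation is the exponential of the
integral of its coefficient, times the initial value. -/
theorem eq_exp_integral_mul_of_hasDerivAt {a D : ℝ → ℂ} (ha : Continuous a)
    (hD : ∀ s, HasDerivAt D (a s * D s) s) (t : ℝ) :
    D t = Complex.exp (∫ s in (0 : ℝ)..t, a s) * D 0 := by
  have hG : ∀ s, HasDerivAt (fun u => Complex.exp (-∫ x in (0 : ℝ)..u, a x) * D u) 0 s := by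
    intro s
    refine ((ha.integral_hasStrictDerivAt 0 s).hasDerivAt.neg.cexp.mul (hD s)).congr_deriv ?_
    simp only [Pi.neg_apply]
    ring
  have h := is_const_of_deriv_eq_zero (fun s => (hG s).differentiableAt) (fun s => (hG s).deriv) t 0
  simp only [intervalIntegral.integral_same, neg_zero, Complex.exp_zero, one_mul] at h
  rw [← h, ← mul_assoc, ← Complex.exp_add, add_neg_cancel, Complex.exp_zero, one_mul]

theorem geometric_phase_sum_is_multiple_of_two_pi
    {d : ℕ} (hd : 1 ≤ d) (T : ℝ) (hT : 0 < T)
    (φ : Fin d → ℝ → EuclideanSpace ℂ (Fin d))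
    (hC1 : ∀ j, ContDiff ℝ 1 (φ j))
    (horth : ∀ s : ℝ, Orthonormal ℂ (fun j => φ j s))
    (hcyc : ∀ j, φ j T = φ j 0) :
    ∃ n : ℤ, ∑ j : Fin d,
        Complex.I * ∫ s in (0:ℝ)..T, ⟪φ j s, deriv (φ j) s⟫_ℂ
      = 2 * Real.pi * (n : ℂ) := by
  have hcard : Module.finrank ℂ (EuclideanSpace ℂ (Fin d)) = Fintype.card (Fin d) := by simp
  have hbasis : ∀ s, ∃ b : OrthonormalBasis (Fin d) ℂ (EuclideanSpace ℂ (Fin d)),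
      ∀ j, b j = φ j s := fun s =>
    ⟨OrthonormalBasis.mk (horth s)
      ((horth s).linearIndependent.span_eq_top_of_card_eq_finrank' hcard.symm).ge, by simp⟩
  choose b hb using hbasis
  let e := (b 0).toBasis
  have hA : ∀ j, Continuous fun s => ⟪φ j s, deriv (φ j) s⟫_ℂ := fun j =>
    (hC1 j).continuous.inner ((hC1 j).continuous_deriv le_rfl)
  have hD : ∀ s, HasDerivAt (fun t => e.det (fun j => φ j t))
      ((∑ j, ⟪φ j s, deriv (φ j) s⟫_ℂ) * e.det (fun j => φ j s)) s := fun s =>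
    hasDerivAt_det_orthonormal e
      (fun j => ((hC1 j).differentiable one_ne_zero s).hasDerivAt) (b s) (hb s)
  have h := eq_exp_integral_mul_of_hasDerivAt (continuous_finsetSum _ fun j _ => hA j) hD T
  have h0 : e.det (fun j => φ j 0) = 1 := by
    rw [← e.det_self]
    congr 1
    ext1 j
    simp [e, hb]
  simp only [hcyc, h0, mul_one] at h
  obtain ⟨n, hn⟩ := Complex.exp_eq_one_iff.1 h.symm
  refine ⟨-n, ?_⟩
  rw [← Finset.mul_sum,
    ← intervalIntegral.integral_finsetSum fun j _ => (hA j).intervalIntegrable 0 T, hn]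
  push_cast
  linear_combination (2 * Real.pi * n : ℂ) * Complex.I_mul_I
end

section
/- Let d ≥ 1 and T > 0, and let φ : Fin d → ℝ → EuclideanSpace ℂ (Fin d) be continuously differentiable curves forming an orthonormal basis at each time and satisfying φ j T = φ j 0 for all j. Then the diagonal geometric-phase gate G = Matrix.diagonal (fun j => exp( − ∫_0^T ⟪φ j s, deriv (φ j) s⟫ ds )) — the unitary acting as |φ_j⟩ ↦ e^{iγ_j}|φ_j⟩ — has determinant 1, i.e. G lies in the special unitary group SU(d). -/
open scoped InnerProductSpace

/-- Jacobi's formula in multilinear form: the determinant is differentiated row by row. -/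
theorem Matrix.hasDerivAt_det_updateRow {n : Type*} [Fintype n] [DecidableEq n]
    {A : ℝ → Matrix n n ℂ} {A' : Matrix n n ℂ} {s : ℝ}
    (hA : ∀ i j, HasDerivAt (fun t => A t i j) (A' i j) s) :
    HasDerivAt (fun t => (A t).det) (∑ i, ((A s).updateRow i (A' i)).det) s := by
  have key : HasDerivAt (fun t => ∑ σ : Equiv.Perm n,
      ((Equiv.Perm.sign σ : ℤ) : ℂ) * ∏ i, A t i (σ i))
      (∑ σ : Equiv.Perm n, ((Equiv.Perm.sign σ : ℤ) : ℂ) *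
        ∑ i, (∏ k ∈ Finset.univ.erase i, A s k (σ k)) • A' i (σ i)) s :=
    HasDerivAt.fun_sum fun σ _ =>
      (HasDerivAt.fun_finsetProd fun i _ => hA i (σ i)).const_mul _
  have hdet : ∀ M : Matrix n n ℂ, M.det =
      ∑ σ : Equiv.Perm n, ((Equiv.Perm.sign σ : ℤ) : ℂ) * ∏ i, M i (σ i) := fun M => by
    rw [← Matrix.det_transpose, Matrix.det_apply']; rfl
  simp only [hdet]
  convert key using 1
  rw [Finset.sum_comm]
  refine Finset.sum_congr rfl fun σ _ => ?_
  rw [Finset.mul_sum]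
  refine Finset.sum_congr rfl fun i _ => ?_
  rw [← Finset.mul_prod_erase _ _ (Finset.mem_univ i), Matrix.updateRow_self, smul_eq_mul,
    mul_comm (A' i (σ i))]
  congr 2
  exact Finset.prod_congr rfl fun k hk => by rw [Matrix.updateRow_ne (Finset.ne_of_mem_erase hk)]

section OrthonormalFrame

variable {ι : Type*} [Fintype ι]

theorem Orthonormal.sum_inner_smul_self {v : ι → EuclideanSpace ℂ ι} (hv : Orthonormal ℂ v)
    (x : EuclideanSpace ℂ ι) : ∑ k, ⟪v k, x⟫_ℂ • v k = x := by
  have hspan : ⊤ ≤ Submodule.span ℂ (Set.range v) :=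
    (hv.linearIndependent.span_eq_top_of_card_eq_finrank' (by simp)).ge
  simpa using (OrthonormalBasis.mk hv hspan).sum_repr' x

variable [DecidableEq ι]

theorem Orthonormal.det_ne_zero {v : ι → EuclideanSpace ℂ ι} (hv : Orthonormal ℂ v) :
    (Matrix.of fun i k => v i k).det ≠ 0 := by
  refine Matrix.det_ne_zero_of_right_inverse (B := (Matrix.of fun i k => v i k).conjTranspose) ?_
  ext i j
  have h := orthonormal_iff_ite.1 hv j i
  rw [PiLp.inner_apply] at h
  simpa [Matrix.mul_apply, Matrix.one_apply, eq_comm] using h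

theorem Orthonormal.hasDerivAt_det {φ : ι → ℝ → EuclideanSpace ℂ ι}
    {φ' : ι → EuclideanSpace ℂ ι} {s : ℝ} (horth : Orthonormal ℂ fun j => φ j s)
    (hφ : ∀ j, HasDerivAt (φ j) (φ' j) s) :
    HasDerivAt (fun t => (Matrix.of fun i k => φ i t k).det)
      ((∑ j, ⟪φ j s, φ' j⟫_ℂ) * (Matrix.of fun i k => φ i s k).det) s := by
  have h := Matrix.hasDerivAt_det_updateRow (A := fun t => Matrix.of fun i k => φ i t k)
    (A' := Matrix.of fun i k => φ' i k) (s := s) fun i k =>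
      (hasDerivAt_pi.1 ((PiLp.hasStrictFDerivAt_ofLp 2 (φ i s)
        (𝕜 := ℝ)).hasFDerivAt.comp_hasDerivAt s (hφ i))) k
  convert h using 1
  rw [Finset.sum_mul]
  refine Finset.sum_congr rfl fun j _ => ?_
  rw [← smul_eq_mul, ← Matrix.det_updateRow_sum _ j fun k => ⟪φ k s, φ' j⟫_ℂ]
  congr 2
  ext l
  simpa using congrArg (fun x : EuclideanSpace ℂ ι => x l) (horth.sum_inner_smul_self (φ' j))

/-- The phases of a periodic orthonormal frame multiply to one. -/
theorem Orthonormal.exp_neg_integral_trace_eq_one {φ : ι → ℝ → EuclideanSpace ℂ ι} {a b : ℝ}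
    (hC1 : ∀ j, ContDiff ℝ 1 (φ j)) (horth : ∀ s, Orthonormal ℂ fun j => φ j s)
    (hcyc : ∀ j, φ j b = φ j a) :
    Complex.exp (-∫ s in a..b, ∑ j, ⟪φ j s, deriv (φ j) s⟫_ℂ) = 1 := by
  set g : ℝ → ℂ := fun s => ∑ j, ⟪φ j s, deriv (φ j) s⟫_ℂ
  set D : ℝ → ℂ := fun s => (Matrix.of fun i k => φ i s k).det with hD
  have hgc : Continuous g := continuous_finsetSum _ fun j _ =>
    (hC1 j).continuous.inner ((hC1 j).continuous_deriv le_rfl)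
  have hder : ∀ s, HasDerivAt (fun t => Complex.exp (-∫ u in a..t, g u) * D t) 0 s := fun s => by
    have hI : HasDerivAt (fun t => ∫ u in a..t, g u) (g s) s :=
      (hgc.integral_hasStrictDerivAt a s).hasDerivAt
    have hDs : HasDerivAt D (g s * D s) s := (horth s).hasDerivAt_det fun j =>
      ((hC1 j).differentiable one_ne_zero s).hasDerivAt
    exact (hI.fun_neg.cexp.fun_mul hDs).congr_deriv (by ring)
  have hconst := is_const_of_deriv_eq_zero (fun s => (hder s).differentiableAt)
    (fun s => (hder s).deriv) b a
  have hDcyc : D b = D a := by simp only [hD, hcyc]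
  rw [hDcyc] at hconst
  simpa using mul_right_cancel₀ (horth a).det_ne_zero hconst

end OrthonormalFrame

theorem star_inner_deriv_of_norm_eq_one {E : Type*} [NormedAddCommGroup E]
    [InnerProductSpace ℂ E] {f : ℝ → E} (hf : Differentiable ℝ f) (hnorm : ∀ s, ‖f s‖ = 1)
    (s : ℝ) : star ⟪f s, deriv f s⟫_ℂ = -⟪f s, deriv f s⟫_ℂ := by
  have h := (hf s).hasDerivAt.inner ℂ (hf s).hasDerivAt
  have hone : (fun t => ⟪f t, f t⟫_ℂ) = fun _ => 1 := by
    funext t; simp [inner_self_eq_norm_sq_to_K, hnorm]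
  rw [hone] at h
  have h0 := h.unique (hasDerivAt_const s (1 : ℂ))
  rw [eq_neg_iff_add_eq_zero, add_comm, ← h0]
  congr 1
  exact inner_conj_symm _ _

theorem geometric_phase_gate_mem_specialUnitaryGroup
    {d : ℕ} (hd : 1 ≤ d) (T : ℝ) (hT : 0 < T)
    (φ : Fin d → ℝ → EuclideanSpace ℂ (Fin d))
    (hC1 : ∀ j, ContDiff ℝ 1 (φ j))
    (horth : ∀ s : ℝ, Orthonormal ℂ (fun j => φ j s))
    (hcyc : ∀ j, φ j T = φ j 0) :
    Matrix.det (Matrix.diagonal (fun j : Fin d =>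
        Complex.exp (- ∫ s in (0:ℝ)..T, ⟪φ j s, deriv (φ j) s⟫_ℂ))) = 1 ∧
    Matrix.diagonal (fun j : Fin d =>
        Complex.exp (- ∫ s in (0:ℝ)..T, ⟪φ j s, deriv (φ j) s⟫_ℂ))
      ∈ Matrix.specialUnitaryGroup (Fin d) ℂ := by
  have hdet : Matrix.det (Matrix.diagonal (fun j : Fin d =>
      Complex.exp (- ∫ s in (0:ℝ)..T, ⟪φ j s, deriv (φ j) s⟫_ℂ))) = 1 := by
    rw [Matrix.det_diagonal, ← Complex.exp_sum, Finset.sum_neg_distrib,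
      ← intervalIntegral.integral_finsetSum fun j _ =>
        ((hC1 j).continuous.inner ((hC1 j).continuous_deriv le_rfl)).intervalIntegrable _ _]
    exact Orthonormal.exp_neg_integral_trace_eq_one hC1 horth hcyc
  refine ⟨hdet, Matrix.mem_specialUnitaryGroup_iff.2 ⟨?_, hdet⟩⟩
  rw [Matrix.mem_unitaryGroup_iff, Matrix.star_eq_conjTranspose, Matrix.diagonal_conjTranspose,
    Matrix.diagonal_mul_diagonal, ← Matrix.diagonal_one]
  congr 1
  funext j
  have hstar : (starRingEnd ℂ) (∫ s in (0:ℝ)..T, ⟪φ j s, deriv (φ j) s⟫_ℂ) =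
      -∫ s in (0:ℝ)..T, ⟪φ j s, deriv (φ j) s⟫_ℂ := by
    rw [← intervalIntegral.intervalIntegral_conj, ← intervalIntegral.integral_neg]
    exact intervalIntegral.integral_congr fun s _ => star_inner_deriv_of_norm_eq_one
      ((hC1 j).differentiable one_ne_zero) (fun t => (horth t).1 j) s
  rw [Pi.star_apply, ← starRingEnd_apply, ← Complex.exp_conj, map_neg, hstar, ← Complex.exp_add]
  simp
end

section
/- For d ≥ 1 define the generalized Hadamard (discrete Fourier transform) gate H_d : Matrix (Fin d) (Fin d) ℂ by (H_d) μ ν = (1/√d) · exp(2πi·μ·ν/d). Then Matrix.det H_3 ≠ 1 and Matrix.det H_4 ≠ 1. Consequently H_3 and H_4 cannot be implemented as diagonal geometric-phase gates, since any such gate has determinant 1. -/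
/-- The generalized Hadamard (discrete Fourier transform) gate
`(H_d) μ ν = (1/√d) · exp(2πi·μ·ν/d)`. -/
noncomputable def hadamardGate (d : ℕ) : Matrix (Fin d) (Fin d) ℂ :=
  Matrix.of fun μ ν : Fin d =>
    (1 / Real.sqrt d : ℂ) *
      Complex.exp (2 * Real.pi * Complex.I * (μ : ℕ) * (ν : ℕ) / d)

theorem hadamardGate_eq_smul_vandermonde (d : ℕ) :
    hadamardGate d = (1 / Real.sqrt d : ℂ) •
      Matrix.vandermonde fun μ : Fin d => Complex.exp (2 * Real.pi * Complex.I / d) ^ (μ : ℕ) := by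
  ext μ ν
  simp only [hadamardGate, Matrix.of_apply, Matrix.smul_apply, Matrix.vandermonde_apply,
    smul_eq_mul, ← Complex.exp_nat_mul]
  congr 2
  ring

theorem one_div_sqrt_natCast_sq (d : ℕ) : (1 / Real.sqrt d : ℂ) ^ 2 = 1 / d := by
  rw [div_pow, one_pow, ← Complex.ofReal_pow, Real.sq_sqrt d.cast_nonneg, Complex.ofReal_natCast]

theorem det_hadamardGate_three_sq : (hadamardGate 3).det ^ 2 = -1 := by
  have hω := Complex.isPrimitiveRoot_exp 3 (by norm_num)
  have hsum := hω.geom_sum_eq_zero (by norm_num)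
  have hc := one_div_sqrt_natCast_sq 3
  rw [hadamardGate_eq_smul_vandermonde, Matrix.det_smul, Fintype.card_fin,
    Matrix.det_fin_three]
  generalize Complex.exp (2 * Real.pi * Complex.I / (3 : ℕ)) = ω at *
  generalize (1 / Real.sqrt (3 : ℕ) : ℂ) = c at *
  have h2 : ω ^ 2 = -1 - ω := by
    simp only [Finset.sum_range_succ, Finset.sum_range_zero] at hsum
    linear_combination hsum
  have h4 : (ω ^ 2) ^ 2 = ω := by linear_combination (ω ^ 2 - ω) * h2
  simp only [Matrix.vandermonde_apply, Fin.val_zero, Fin.val_one, Fin.val_two, pow_zero, pow_one,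
    one_pow, h4]
  rw [mul_pow, ← pow_mul, mul_comm 3 2, pow_mul, hc, h2]
  push_cast
  linear_combination (4 / 3) * h2

theorem det_hadamardGate_four_sq : (hadamardGate 4).det ^ 2 = -1 := by
  have hω := Complex.isPrimitiveRoot_exp 4 (by norm_num)
  have hc := one_div_sqrt_natCast_sq 4
  have h2 := (hω.pow (by norm_num) (show 4 = 2 * 2 by norm_num)).eq_neg_one_of_two_right
  rw [hadamardGate_eq_smul_vandermonde, Matrix.det_smul, Fintype.card_fin,
    Matrix.det_vandermonde]
  generalize Complex.exp (2 * Real.pi * Complex.I / (4 : ℕ)) = ω at *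
  generalize (1 / Real.sqrt (4 : ℕ) : ℂ) = c at *
  have h3 : ω ^ 3 = -ω := by linear_combination ω * h2
  have hV : (∏ i : Fin 4, ∏ j ∈ Finset.Ioi i, (ω ^ (j : ℕ) - ω ^ (i : ℕ))) =
      (ω - 1) * (ω ^ 2 - 1) * (ω ^ 3 - 1) * ((ω ^ 2 - ω) * (ω ^ 3 - ω)) * (ω ^ 3 - ω ^ 2) := by
    rw [Fin.prod_univ_four, show Finset.Ioi (0 : Fin 4) = {1, 2, 3} by decide,
      show Finset.Ioi (1 : Fin 4) = {2, 3} by decide, show Finset.Ioi (2 : Fin 4) = {3} by decide,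
      show Finset.Ioi (3 : Fin 4) = ∅ by decide]
    simp [mul_assoc]
  have hV' : (ω - 1) * (ω ^ 2 - 1) * (ω ^ 3 - 1) * ((ω ^ 2 - ω) * (ω ^ 3 - ω)) * (ω ^ 3 - ω ^ 2) =
      -16 * ω := by
    rw [h3, h2]
    grind
  rw [hV, hV', mul_pow, ← pow_mul, mul_comm 4 2, pow_mul, hc, mul_pow, h2]
  norm_num

theorem hadamard_det_ne_one :
    Matrix.det (hadamardGate 3) ≠ 1 ∧ Matrix.det (hadamardGate 4) ≠ 1 := by
  constructor <;> intro h
  · have := det_hadamardGate_three_sq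
    norm_num [h] at this
  · have := det_hadamardGate_four_sq
    norm_num [h] at this
end
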